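/- Suppose M is (odd, odd)-free and that: (1) for every Z ⊆ S, the Artin group of the matrix M restricted to Z admits ordinary retractions; and (2) for every Z ⊆ S, all X, Y ⊆ Z and every g in the Artin group A_Z of M restricted to Z, if every z ∈ Z \ (C_{X,Y} ∪ C_{Y,X}) satisfies M z t < ∞ for all t ∈ Z (i.e. the star of z in Z is all of Z), then either A_{C_{X,Y}} = g·A_{C_{Y,X}}·g⁻¹ in A_Z, or there exist d ∈ A_Z and H ⊆ Z with H ⊊ C_{X,Y} or H ⊊ C_{Y,X} such that A_{C_{X,Y}} ∩ g·A_{C_{Y,X}}·g⁻¹ ≤ d·A_H·d⁻¹ in A_Z. Then the intersection of any two parabolic subgroups of A_M is again a parabolic subgroup of A_M. -/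

import Mathlib

/-- `altProd u v m` is the alternating product `u * v * u * v * ⋯` with `m` factors. -/
def altProd {G : Type*} [Monoid G] : G → G → ℕ → G
  | _, _, 0 => 1
  | u, v, n + 1 => u * altProd v u n

/-- The relation set of the Artin group of the labelled Coxeter matrix `M`
(label `⊤` meaning no relation). -/
def ArtinRels {S : Type*} (M : S → S → ℕ∞) : Set (FreeGroup S) :=
  { r | ∃ (s t : S) (m : ℕ), s ≠ t ∧ M s t = (m : ℕ∞) ∧
        r = altProd (FreeGroup.of s) (FreeGroup.of t) m *
            (altProd (FreeGroup.of t) (FreeGroup.of s) m)⁻¹ }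

/-- The Artin group of the labelled Coxeter matrix `M`. -/
abbrev ArtinGroup {S : Type*} (M : S → S → ℕ∞) :=
  PresentedGroup (ArtinRels M)

/-- The image in the Artin group of the generator `s`. -/
def agen {S : Type*} (M : S → S → ℕ∞) (s : S) : ArtinGroup M :=
  PresentedGroup.of s

/-- The standard parabolic subgroup of the Artin group generated by `X ⊆ S`. -/
def parabolic {S : Type*} (M : S → S → ℕ∞) (X : Set S) : Subgroup (ArtinGroup M) :=
  Subgroup.closure (agen M '' X)

/-- The conjugate `g H g⁻¹` of a subgroup `H`. -/
def conjSub {G : Type*} [Group G] (g : G) (H : Subgroup G) : Subgroup G :=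
  H.map (MulAut.conj g).toMonoidHom

/-- `ρ` is a retraction of `G` onto its subgroup `H`: its image is contained in `H`
and it fixes every element of `H`. -/
def IsRetraction {G : Type*} [Group G] (ρ : G →* G) (H : Subgroup G) : Prop :=
  (∀ g, ρ g ∈ H) ∧ ∀ h ∈ H, ρ h = h

/-- The extended natural number `x` is finite and odd. -/
def OddLab (x : ℕ∞) : Prop := ∃ m : ℕ, x = (m : ℕ∞) ∧ Odd m

/-- The extended natural number `x` is finite and even. -/
def EvenFin (x : ℕ∞) : Prop := ∃ m : ℕ, x = (m : ℕ∞) ∧ Even m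

/-- The extended natural number `x` is even or equal to `∞`. -/
def EvenOrInf (x : ℕ∞) : Prop := ∀ m : ℕ, x = (m : ℕ∞) → Even m

/-- `ρ` is the ordinary retraction of the Artin group of `M` onto the standard
parabolic subgroup over `X`: it is a retraction onto `A_X`, it fixes the generators
in `X`, it sends a generator `v ∉ X` joined to some `a ∈ X` by an odd label to `a`,
and it kills the generators `v ∉ X` all of whose labels towards `X` are even or `∞`. -/
def IsOrdinaryRetraction {S : Type*} (M : S → S → ℕ∞) (X : Set S)
    (ρ : ArtinGroup M →* ArtinGroup M) : Prop :=
  IsRetraction ρ (parabolic M X) ∧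
  (∀ s ∈ X, ρ (agen M s) = agen M s) ∧
  (∀ v ∉ X, ∀ a ∈ X, OddLab (M v a) → ρ (agen M v) = agen M a) ∧
  (∀ v ∉ X, (∀ a ∈ X, EvenOrInf (M v a)) → ρ (agen M v) = 1)

/-- `M` has no two consecutive odd-labelled edges. -/
def OddOddFree {S : Type*} (M : S → S → ℕ∞) : Prop :=
  ¬ ∃ s t u : S, s ≠ t ∧ t ≠ u ∧ s ≠ u ∧ OddLab (M s t) ∧ OddLab (M t u)

/-- `O_{X,Y}`: the elements of `X \ Y` joined to some element of `Y \ X` by an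
odd label. -/
def Oset {S : Type*} (M : S → S → ℕ∞) (X Y : Set S) : Set S :=
  {x | x ∈ X \ Y ∧ ∃ y ∈ Y \ X, OddLab (M x y)}

/-- `C_{X,Y} = (X ∩ Y) ∪ O_{X,Y}`. -/
def Cset {S : Type*} (M : S → S → ℕ∞) (X Y : Set S) : Set S :=
  (X ∩ Y) ∪ Oset M X Y

/-- The link of `s`: the vertices joined to `s` by a finite label. -/
def lkset {S : Type*} (M : S → S → ℕ∞) (s : S) : Set S :=
  {t | t ≠ s ∧ M s t ≠ ⊤}

/-- The restriction of the labelled Coxeter matrix `M` to a subset `Z ⊆ S`. -/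
def Mres {S : Type*} (M : S → S → ℕ∞) (Z : Set S) : Z → Z → ℕ∞ :=
  fun s t => M (s : S) (t : S)

section Alternating

variable {G : Type*}

theorem map_altProd {H : Type*} [Monoid G] [Monoid H] (f : G →* H) (u v : G) (m : ℕ) :
    f (altProd u v m) = altProd (f u) (f v) m := by
  induction m generalizing u v with
  | zero => simp [altProd]
  | succ n ih => simp [altProd, ih]

theorem altProd_add [Monoid G] (u v : G) (m n : ℕ) :
    altProd u v (m + n) =
      altProd u v m * (if Even m then altProd u v n else altProd v u n) := by
  induction m generalizing u v with
  | zero => simp [altProd]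
  | succ m ih =>
    rw [Nat.add_right_comm]
    by_cases h : Even m <;> simp [altProd, ih, Nat.even_add_one, h, mul_assoc]

theorem altProd_comm_of_dvd [Monoid G] {u v : G} {m n : ℕ}
    (h : altProd u v n = altProd v u n) (hmn : n ∣ m) : altProd u v m = altProd v u m := by
  obtain ⟨k, rfl⟩ := hmn
  induction k with
  | zero => simp [altProd]
  | succ k ih => rw [Nat.mul_succ, Nat.add_comm, altProd_add, altProd_add v u, h, ih]

theorem altProd_two_mul [Monoid G] (u v : G) (k : ℕ) : altProd u v (2 * k) = (u * v) ^ k := by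
  induction k with
  | zero => simp [altProd]
  | succ k ih => rw [Nat.mul_succ, Nat.add_comm, altProd_add, ih, pow_succ']; simp [altProd]

theorem altProd_two_mul_add_one [Monoid G] (u v : G) (k : ℕ) :
    altProd u v (2 * k + 1) = (u * v) ^ k * u := by
  rw [altProd_add, altProd_two_mul]; simp [altProd]

theorem altProd_even_one_comm [Monoid G] (u : G) {m : ℕ} (hm : Even m) :
    altProd u 1 m = altProd 1 u m := by
  obtain ⟨k, rfl⟩ := hm.two_dvd
  simp [altProd_two_mul]

theorem altProd_comm_of_involutions [Group G] {u v : G} (hu : u * u = 1) (hv : v * v = 1)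
    {m : ℕ} (h : (u * v) ^ m = 1) : altProd u v m = altProd v u m := by
  have hinv : v * u = (u * v)⁻¹ := by
    rw [mul_inv_rev, ← eq_inv_of_mul_eq_one_left hu, ← eq_inv_of_mul_eq_one_left hv]
  obtain ⟨k, rfl | rfl⟩ := Nat.even_or_odd' m
  · rw [altProd_two_mul, altProd_two_mul, hinv, inv_pow, eq_inv_iff_mul_eq_one, ← pow_add,
      ← two_mul, h]
  · rw [altProd_two_mul_add_one, altProd_two_mul_add_one, hinv, inv_pow, eq_inv_mul_iff_mul_eq,
      ← mul_assoc, ← pow_add, ← two_mul]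
    rw [pow_succ, ← mul_assoc, mul_eq_one_iff_eq_inv, ← eq_inv_of_mul_eq_one_left hv] at h
    exact h

theorem mul_pow_eq_one_of_altProd_comm [Group G] {u v : G} (hu : u * u = 1) (hv : v * v = 1)
    {m : ℕ} (hm : Even m) (h : altProd u v m = altProd v u m) : (u * v) ^ m = 1 := by
  have hinv : v * u = (u * v)⁻¹ := by
    rw [mul_inv_rev, ← eq_inv_of_mul_eq_one_left hu, ← eq_inv_of_mul_eq_one_left hv]
  obtain ⟨k, rfl⟩ := hm.two_dvd
  rwa [altProd_two_mul, altProd_two_mul, hinv, inv_pow, eq_inv_iff_mul_eq_one, ← pow_add,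
      ← two_mul] at h

end Alternating

section Dihedral

open Module Polynomial.Chebyshev

variable {V : Type*} [AddCommGroup V] [Module ℝ V] {x y : V} {f g : Dual ℝ V}

theorem sin_two_pi_div_pos {m : ℕ} (hm : 3 ≤ m) : 0 < Real.sin (2 * Real.pi / m) := by
  have h3 : (3 : ℝ) ≤ m := by exact_mod_cast hm
  apply Real.sin_pos_of_pos_of_lt_pi
  · have := Real.pi_pos; positivity
  · rw [div_lt_iff₀ (by linarith)]; nlinarith [Real.pi_pos]

theorem chebyshevS_coeff_sum_eq_zero {m : ℕ} (hm : 3 ≤ m) :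
    let t := 2 * Real.cos (2 * Real.pi / m)
    ((S ℝ (((m : ℤ) - 2) / 2)).eval t * ((S ℝ (((m : ℤ) - 1) / 2)).eval t
        + (S ℝ (((m : ℤ) - 3) / 2)).eval t)) = 0 ∧
      ((S ℝ (((m : ℤ) - 1) / 2)).eval t * ((S ℝ ((m : ℤ) / 2)).eval t
        + (S ℝ (((m : ℤ) - 2) / 2)).eval t)) = 0 := by
  intro t
  have hs := sin_two_pi_div_pos hm
  set θ := 2 * Real.pi / m with hθ
  have hm0 : (m : ℝ) ≠ 0 := by positivity
  have key (n : ℤ) : (S ℝ n).eval t * Real.sin θ = Real.sin ((n + 1) * θ) := S_two_mul_real_cos θ n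
  obtain ⟨k, hk | hk⟩ := Nat.even_or_odd' m
  · have h1 : ((m : ℤ) - 2) / 2 = k - 1 := by lia
    have h2 : ((m : ℤ) - 1) / 2 = k - 1 := by lia
    have h0 : (S ℝ ((k : ℤ) - 1)).eval t = 0 := by
      have h := key (k - 1)
      have e : (((k : ℤ) - 1 : ℤ) + 1 : ℝ) * θ = Real.pi := by
        have hk0 : (k : ℝ) ≠ 0 := by rintro h; simp [hk, h] at hm0
        rw [hθ, hk]; push_cast; field_simp; ring
      rw [e, Real.sin_pi] at h
      exact (mul_eq_zero.mp h).resolve_right hs.ne'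
    rw [h1, h2, h0]; simp
  · have h1 : ((m : ℤ) - 2) / 2 = k - 1 := by lia
    have h2 : ((m : ℤ) - 1) / 2 = k := by lia
    have h3 : ((m : ℤ) - 3) / 2 = k - 1 := by lia
    have h4 : (m : ℤ) / 2 = k := by lia
    have h0 : (S ℝ (k : ℤ)).eval t + (S ℝ ((k : ℤ) - 1)).eval t = 0 := by
      have ha := key k
      have hb := key (k - 1)
      have e : ((k : ℤ) + 1 : ℝ) * θ = 2 * Real.pi - (((k : ℤ) - 1 : ℤ) + 1 : ℝ) * θ := by
        rw [hθ, hk]; push_cast; rw [hk] at hm0; push_cast at hm0; field_simp; ring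
      rw [e, Real.sin_two_pi_sub] at ha
      have : ((S ℝ (k : ℤ)).eval t + (S ℝ ((k : ℤ) - 1)).eval t) * Real.sin θ = 0 := by
        rw [add_mul, ha, hb]; ring
      exact (mul_eq_zero.mp this).resolve_right hs.ne'
    rw [h1, h2, h3, h4, h0]; simp

theorem reflection_mul_reflection_pow_eq_one (hf : f x = 2) (hg : g y = 2) {m : ℕ} (hm : 2 ≤ m)
    (hfy : f y = -2 * Real.cos (Real.pi / m)) (hgx : g x = -2 * Real.cos (Real.pi / m)) :
    (reflection hf * reflection hg) ^ m = 1 := by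
  ext z
  rcases hm.eq_or_lt with rfl | hm
  · have hfy' : f y = 0 := by rw [hfy]; simp
    have hgx' : g x = 0 := by rw [hgx]; simp
    simp only [pow_two, LinearEquiv.mul_apply, reflection_apply, map_sub, map_smul, hf, hg,
      hfy', hgx', LinearEquiv.coe_one, id]
    module
  · have ht : 2 * Real.cos (2 * Real.pi / m) = f y * g x - 2 := by
      rw [hfy, hgx, mul_div_assoc, Real.cos_two_mul]; ring
    obtain ⟨h1, h2⟩ := chebyshevS_coeff_sum_eq_zero hm
    rw [reflection_mul_reflection_pow_apply hf hg m z _ ht, h1, h2]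
    simp

theorem dvd_of_reflection_mul_reflection_pow_eq_one (hf : f x = 2) (hg : g y = 2)
    (hxy : LinearIndependent ℝ ![x, y]) {n m : ℕ} (hn : 3 ≤ n)
    (hfy : f y = -2 * Real.cos (Real.pi / n)) (hgx : g x = -2 * Real.cos (Real.pi / n))
    (h : (reflection hf * reflection hg) ^ m = 1) : n ∣ m := by
  have ht : 2 * Real.cos (2 * Real.pi / n) = f y * g x - 2 := by
    rw [hfy, hgx, mul_div_assoc, Real.cos_two_mul]; ring
  have h1 := reflection_mul_reflection_pow_apply_self hf hg m _ ht
  rw [h, LinearEquiv.coe_one, id] at h1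
  have hs := sin_two_pi_div_pos hn
  set θ := 2 * Real.pi / n with hθ
  set t := 2 * Real.cos θ
  have key (n : ℤ) : (S ℝ n).eval t * Real.sin θ = Real.sin ((n + 1) * θ) := S_two_mul_real_cos θ n
  have h2 : ((S ℝ m).eval t + (S ℝ (m - 1)).eval t - 1) • x +
      ((S ℝ (m - 1)).eval t * -g x) • y = 0 := by
    rw [sub_smul, one_smul, sub_add_eq_add_sub, ← h1, sub_self]
  obtain ⟨ha, hb⟩ := LinearIndependent.pair_iff.mp hxy _ _ h2
  have hgx0 : -g x ≠ 0 := by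
    have h3 : (3 : ℝ) ≤ n := by exact_mod_cast hn
    have : 0 < Real.cos (Real.pi / n) := by
      apply Real.cos_pos_of_mem_Ioo
      constructor
      · have : 0 < Real.pi / n := by have := Real.pi_pos; positivity
        linarith [Real.pi_pos]
      · rw [div_lt_iff₀ (by linarith)]; nlinarith [Real.pi_pos]
    rw [hgx]; simpa using this.ne'
  have hb' := (mul_eq_zero.mp hb).resolve_right hgx0
  have k1 := key (m - 1)
  have k2 := key m
  rw [hb', zero_mul] at k1
  have hm1 : (S ℝ m).eval t = 1 := by linarith
  have k1' : Real.sin (m * θ) = 0 := by rw [k1]; push_cast; ring_nf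
  rw [hm1, one_mul] at k2
  have k3 : Real.cos (m * θ) = 1 := by
    have : Real.sin θ = Real.cos (m * θ) * Real.sin θ := by
      conv_lhs => rw [k2]
      push_cast
      rw [add_mul, one_mul, Real.sin_add, k1']; ring
    exact mul_right_cancel₀ hs.ne' (by rw [one_mul, ← this])
  obtain ⟨k, hk⟩ := (Real.cos_eq_one_iff _).mp k3
  have hn0 : (n : ℝ) ≠ 0 := by positivity
  have : (m : ℝ) = n * k := by
    rw [hθ] at hk
    field_simp at hk
    rw [← hk, mul_comm]
  have : (m : ℤ) = n * k := by exact_mod_cast this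
  exact Int.natCast_dvd_natCast.mp ⟨k, this⟩

theorem eq_zero_of_reflection_mul_reflection_pow_eq_one (hf : f x = 2) (hg : g y = 2)
    (hxy : LinearIndependent ℝ ![x, y]) {m : ℕ} (hfy : f y = -2) (hgx : g x = -2)
    (h : (reflection hf * reflection hg) ^ m = 1) : m = 0 := by
  have ht : (2 : ℝ) = f y * g x - 2 := by rw [hfy, hgx]; norm_num
  have h1 := reflection_mul_reflection_pow_apply_self hf hg m _ ht
  rw [h, LinearEquiv.coe_one, id, S_eval_two, S_eval_two, hgx] at h1
  push_cast at h1
  have h2 : ((2 * m : ℝ)) • x + (2 * m : ℝ) • y = 0 := by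
    have e : (2 * m : ℝ) • x + (2 * m : ℝ) • y =
      (m + 1 + ((m : ℝ) - 1 + 1)) • x + (((m : ℝ) - 1 + 1) * - -2) • y - x := by module
    rw [e, ← h1, sub_self]
  have := (LinearIndependent.pair_iff.mp hxy _ _ h2).1
  simpa using this

end Dihedral

section Tits

open Module

variable {S : Type*} (M : S → S → ℕ∞)

/-- Twice the value of the canonical symmetric bilinear form of a Coxeter matrix on a pair of
simple roots whose label is `n`. -/
noncomputable def titsCoeff (n : ℕ∞) : ℝ :=
  if n = ⊤ then -2 else -2 * Real.cos (Real.pi / n.toNat)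

/-- The simple coroot of `s` in the geometric representation of the Coxeter matrix `M`. -/
noncomputable def simpleCoroot (s : S) : Dual ℝ (S →₀ ℝ) :=
  Finsupp.linearCombination ℝ fun t => titsCoeff (M s t)

theorem simpleCoroot_single (s t : S) :
    simpleCoroot M s (Finsupp.single t 1) = titsCoeff (M s t) := by
  simp [simpleCoroot]

variable {M}

theorem simpleCoroot_single_self (hdiag : ∀ s, M s s = 1) (s : S) :
    simpleCoroot M s (Finsupp.single s 1) = 2 := by
  simp [simpleCoroot_single, hdiag, titsCoeff]

theorem reflection_mul_self {V : Type*} [AddCommGroup V] [Module ℝ V] {x : V} {f : Dual ℝ V}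
    (h : f x = 2) : reflection h * reflection h = 1 :=
  mul_eq_one_iff_eq_inv.mpr (reflection_inv h).symm

/-- The geometric representation of the Coxeter group of `M`, inflated to the Artin group. -/
noncomputable def geometricRep (hsymm : ∀ s t, M s t = M t s) (hdiag : ∀ s, M s s = 1)
    (hge2 : ∀ s t, s ≠ t → 2 ≤ M s t) : ArtinGroup M →* ((S →₀ ℝ) ≃ₗ[ℝ] (S →₀ ℝ)) :=
  PresentedGroup.toGroup (f := fun s => reflection (simpleCoroot_single_self hdiag s)) <| by
    rintro _ ⟨s, t, m, hst, hm, rfl⟩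
    rw [map_mul, map_inv, mul_inv_eq_one, map_altProd, map_altProd]
    simp only [FreeGroup.lift_apply_of]
    have h2 : 2 ≤ m := by have := hge2 s t hst; rw [hm] at this; exact_mod_cast this
    apply altProd_comm_of_involutions (reflection_mul_self _) (reflection_mul_self _)
    apply reflection_mul_reflection_pow_eq_one _ _ h2
    · rw [simpleCoroot_single, hm]; simp [titsCoeff]
    · rw [simpleCoroot_single, hsymm, hm]; simp [titsCoeff]

theorem geometricRep_agen (hsymm : ∀ s t, M s t = M t s) (hdiag : ∀ s, M s s = 1)
    (hge2 : ∀ s t, s ≠ t → 2 ≤ M s t) (s : S) :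
    geometricRep hsymm hdiag hge2 (agen M s) = reflection (simpleCoroot_single_self hdiag s) :=
  PresentedGroup.toGroup.of _

theorem label_dvd_of_altProd_agen_comm (hsymm : ∀ s t, M s t = M t s) (hdiag : ∀ s, M s s = 1)
    (hge2 : ∀ s t, s ≠ t → 2 ≤ M s t) {a b : S} (hab : a ≠ b) {m : ℕ} (hm : Even m) (hm0 : m ≠ 0)
    (h : altProd (agen M a) (agen M b) m = altProd (agen M b) (agen M a) m) :
    ∃ n : ℕ, M a b = n ∧ n ∣ m := by
  have h1 := congrArg (geometricRep hsymm hdiag hge2) h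
  rw [map_altProd, map_altProd, geometricRep_agen, geometricRep_agen] at h1
  have h2 := mul_pow_eq_one_of_altProd_comm (reflection_mul_self _) (reflection_mul_self _) hm h1
  have hli : LinearIndependent ℝ ![Finsupp.single a (1 : ℝ), Finsupp.single b 1] := by
    refine LinearIndependent.pair_iff.mpr fun c d hcd => ?_
    have ha := DFunLike.congr_fun hcd a
    have hb := DFunLike.congr_fun hcd b
    simp [hab, hab.symm] at ha hb
    exact ⟨ha, hb⟩
  cases hM : M a b with
  | top =>
    refine absurd (eq_zero_of_reflection_mul_reflection_pow_eq_one _ _ hli ?_ ?_ h2) hm0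
    · simp [simpleCoroot_single, hM, titsCoeff]
    · simp [simpleCoroot_single, hsymm b a, hM, titsCoeff]
  | coe n =>
    refine ⟨n, rfl, ?_⟩
    have hn2 : 2 ≤ n := by have := hge2 a b hab; rw [hM] at this; exact_mod_cast this
    rcases hn2.eq_or_lt with rfl | hn3
    · exact hm.two_dvd
    · apply dvd_of_reflection_mul_reflection_pow_eq_one _ _ hli hn3 _ _ h2
      · simp [simpleCoroot_single, hM, titsCoeff]
      · simp [simpleCoroot_single, hsymm b a, hM, titsCoeff]

end Tits

section ArtinMaps

variable {S T : Type*}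

/-- The homomorphism of Artin groups induced by a label-preserving injection of Coxeter
graphs. -/
def ArtinGroup.map {M : S → S → ℕ∞} {N : T → T → ℕ∞} (f : S → T) (hf : Function.Injective f)
    (hMN : ∀ s t, N (f s) (f t) = M s t) : ArtinGroup M →* ArtinGroup N :=
  PresentedGroup.toGroup (f := fun s => agen N (f s)) <| by
    rintro _ ⟨s, t, m, hst, hm, rfl⟩
    rw [map_mul, map_inv, mul_inv_eq_one, map_altProd, map_altProd]
    simp only [FreeGroup.lift_apply_of]
    have h : PresentedGroup.mk (ArtinRels N) (altProd (FreeGroup.of (f s)) (FreeGroup.of (f t)) m *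
        (altProd (FreeGroup.of (f t)) (FreeGroup.of (f s)) m)⁻¹) = 1 :=
      PresentedGroup.one_of_mem ⟨f s, f t, m, hf.ne hst, by rw [hMN, hm], rfl⟩
    rwa [map_mul, map_inv, mul_inv_eq_one, map_altProd, map_altProd] at h

theorem ArtinGroup.map_agen {M : S → S → ℕ∞} {N : T → T → ℕ∞} (f : S → T)
    (hf : Function.Injective f) (hMN : ∀ s t, N (f s) (f t) = M s t) (s : S) :
    ArtinGroup.map f hf hMN (agen M s) = agen N (f s) :=
  PresentedGroup.toGroup.of _

theorem ArtinGroup.hom_ext {M : S → S → ℕ∞} {G : Type*} [Group G] {f g : ArtinGroup M →* G}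
    (h : ∀ s, f (agen M s) = g (agen M s)) : f = g :=
  PresentedGroup.ext h

theorem altProd_agen_comm (M : S → S → ℕ∞) {s t : S} (hst : s ≠ t) {m : ℕ} (hm : M s t = m) :
    altProd (agen M s) (agen M t) m = altProd (agen M t) (agen M s) m := by
  have h : PresentedGroup.mk (ArtinRels M) (altProd (FreeGroup.of s) (FreeGroup.of t) m *
      (altProd (FreeGroup.of t) (FreeGroup.of s) m)⁻¹) = 1 :=
    PresentedGroup.one_of_mem ⟨s, t, m, hst, hm, rfl⟩
  rwa [map_mul, map_inv, mul_inv_eq_one, map_altProd, map_altProd] at h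

/-- The canonical map from the Artin group of an induced subgraph. -/
def inducedHom (M : S → S → ℕ∞) (Z : Set S) : ArtinGroup (Mres M Z) →* ArtinGroup M :=
  ArtinGroup.map Subtype.val Subtype.val_injective fun _ _ => rfl

@[simp]
theorem inducedHom_agen (M : S → S → ℕ∞) (Z : Set S) (s : Z) :
    inducedHom M Z (agen (Mres M Z) s) = agen M s :=
  ArtinGroup.map_agen _ _ _ s

theorem map_inducedHom_parabolic (M : S → S → ℕ∞) (Z : Set S) (X : Set Z) :
    (parabolic (Mres M Z) X).map (inducedHom M Z) = parabolic M (Subtype.val '' X) := by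
  rw [parabolic, parabolic, MonoidHom.map_closure, Set.image_image, Set.image_image]
  simp

theorem range_inducedHom (M : S → S → ℕ∞) (Z : Set S) :
    (inducedHom M Z).range = parabolic M Z := by
  have h : parabolic (Mres M Z) Set.univ = ⊤ := by
    rw [parabolic, Set.image_univ]
    exact PresentedGroup.closure_range_of _
  rw [MonoidHom.range_eq_map, ← h, map_inducedHom_parabolic]
  simp

theorem agen_mem_parabolic {M : S → S → ℕ∞} {X : Set S} {s : S} (hs : s ∈ X) :
    agen M s ∈ parabolic M X :=
  Subgroup.subset_closure ⟨s, hs, rfl⟩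

theorem parabolic_mono (M : S → S → ℕ∞) {X Y : Set S} (h : X ⊆ Y) :
    parabolic M X ≤ parabolic M Y :=
  Subgroup.closure_mono (Set.image_mono h)

end ArtinMaps

section Retractions

variable {S : Type*} {M : S → S → ℕ∞}

theorem oddLab_or_evenOrInf (X : Set S) (v : S) :
    (∃ a ∈ X, OddLab (M v a)) ∨ ∀ a ∈ X, EvenOrInf (M v a) := by
  by_contra! h
  obtain ⟨h1, a, ha, h2⟩ := h
  simp only [EvenOrInf, not_forall, Nat.not_even_iff_odd] at h2
  obtain ⟨m, hm, hodd⟩ := h2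
  exact h1 a ha ⟨m, hm, hodd⟩

theorem OddOddFree.eq_of_oddLab (hfree : OddOddFree M) {s t u : S} (hst : s ≠ t) (htu : t ≠ u)
    (h1 : OddLab (M s t)) (h2 : OddLab (M t u)) : s = u := by
  by_contra h
  exact hfree ⟨s, t, u, hst, htu, h, h1, h2⟩

theorem exists_isOrdinaryRetraction_of_univ
    (hord : ∀ X : Set (Set.univ : Set S), ∃ ρ, IsOrdinaryRetraction (Mres M Set.univ) X ρ)
    (X : Set S) : ∃ ρ, IsOrdinaryRetraction M X ρ := by
  obtain ⟨ρ, ⟨hρ1, hρ2⟩, hρ3, hρ4, hρ5⟩ := hord (Subtype.val ⁻¹' X)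
  let κ : ArtinGroup M →* ArtinGroup (Mres M Set.univ) :=
    ArtinGroup.map (fun s => ⟨s, trivial⟩) (fun _ _ h => congrArg Subtype.val h) fun _ _ => rfl
  have hκ (s : S) : κ (agen M s) = agen (Mres M Set.univ) ⟨s, trivial⟩ :=
    ArtinGroup.map_agen _ _ _ s
  have hX : (parabolic (Mres M Set.univ) (Subtype.val ⁻¹' X)).map (inducedHom M Set.univ) =
      parabolic M X := by
    rw [map_inducedHom_parabolic, Subtype.image_preimage_coe, Set.univ_inter]
  have hfix (s : S) (hs : s ∈ X) :
      ((inducedHom M Set.univ).comp (ρ.comp κ)) (agen M s) = agen M s := by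
    simp only [MonoidHom.comp_apply]
    rw [hκ, hρ3 _ hs, inducedHom_agen]
  refine ⟨(inducedHom M Set.univ).comp (ρ.comp κ), ⟨fun g => ?_, fun h hh => ?_⟩, hfix,
    fun v hv a ha hva => ?_, fun v hv hva => ?_⟩
  · rw [← hX]
    exact Subgroup.mem_map_of_mem _ (hρ1 _)
  · exact MonoidHom.eqOn_closure (f := (inducedHom M Set.univ).comp (ρ.comp κ))
      (g := MonoidHom.id _) (by rintro _ ⟨s, hs, rfl⟩; exact hfix s hs) hh
  · simp only [MonoidHom.comp_apply]
    rw [hκ, hρ4 ⟨v, trivial⟩ hv ⟨a, trivial⟩ ha hva, inducedHom_agen]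
  · simp only [MonoidHom.comp_apply]
    rw [hκ, hρ5 ⟨v, trivial⟩ hv fun a ha => hva a ha, map_one]

theorem IsOrdinaryRetraction.map_parabolic (hsymm : ∀ s t, M s t = M t s) {X : Set S}
    {ρ : ArtinGroup M →* ArtinGroup M} (hρ : IsOrdinaryRetraction M X ρ) (Y : Set S) :
    (parabolic M Y).map ρ = parabolic M (Cset M X Y) := by
  obtain ⟨-, h1, h2, h3⟩ := hρ
  rw [parabolic, MonoidHom.map_closure]
  apply le_antisymm
  · rw [Subgroup.closure_le]
    rintro _ ⟨_, ⟨y, hy, rfl⟩, rfl⟩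
    by_cases hyX : y ∈ X
    · rw [h1 y hyX]
      exact agen_mem_parabolic (Or.inl ⟨hyX, hy⟩)
    obtain ⟨a, ha, hya⟩ | h := oddLab_or_evenOrInf (M := M) X y
    · rw [h2 y hyX a ha hya]
      refine agen_mem_parabolic ?_
      by_cases haY : a ∈ Y
      · exact Or.inl ⟨ha, haY⟩
      · exact Or.inr ⟨⟨ha, haY⟩, y, ⟨hy, hyX⟩, hsymm y a ▸ hya⟩
    · rw [h3 y hyX h]
      exact one_mem _
  · refine Subgroup.closure_mono ?_
    rintro _ ⟨c, ⟨hcX, hcY⟩ | ⟨⟨hcX, -⟩, y, ⟨hyY, hyX⟩, hcy⟩, rfl⟩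
    · exact ⟨_, ⟨c, hcY, rfl⟩, h1 c hcX⟩
    · exact ⟨_, ⟨y, hyY, rfl⟩, h2 y hyX c hcX (hsymm c y ▸ hcy)⟩

open Classical in
/-- The vertex of `X` to which an ordinary retraction onto `A_X` sends `v`, if any. -/
noncomputable def retractVertex (M : S → S → ℕ∞) (X : Set S) (v : S) : Option X :=
  if h : v ∈ X then some ⟨v, h⟩
  else if h : ∃ a : X, OddLab (M v a) then some h.choose else none

theorem retractVertex_of_mem {X : Set S} (v : X) : retractVertex M X v = some v := by
  simp [retractVertex]

theorem oddLab_of_retractVertex {X : Set S} {v : S} {a : X} (hv : v ∉ X)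
    (h : retractVertex M X v = some a) : OddLab (M v a) := by
  rw [retractVertex, dif_neg hv] at h
  split_ifs at h with h'
  exact Option.some_injective _ h ▸ h'.choose_spec

theorem evenOrInf_of_retractVertex {X : Set S} {v : S} (h : retractVertex M X v = none) :
    v ∉ X ∧ ∀ a ∈ X, EvenOrInf (M v a) := by
  rw [retractVertex] at h
  split_ifs at h with h1 h2
  refine ⟨h1, (oddLab_or_evenOrInf X v).resolve_left ?_⟩
  rintro ⟨a, ha, hva⟩
  exact h2 ⟨⟨a, ha⟩, hva⟩

theorem IsOrdinaryRetraction.apply_agen {X : Set S} {ρ : ArtinGroup M →* ArtinGroup M}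
    (hρ : IsOrdinaryRetraction M X ρ) {v : S} {a : X} (h : retractVertex M X v = some a) :
    ρ (agen M v) = agen M a := by
  by_cases hv : v ∈ X
  · obtain rfl : ⟨v, hv⟩ = a := by
      simpa [retractVertex_of_mem (⟨v, hv⟩ : X)] using h
    exact hρ.2.1 v hv
  · exact hρ.2.2.1 v hv a a.2 (oddLab_of_retractVertex hv h)

theorem even_of_retractVertex_eq_none (hfree : OddOddFree M)
    (hsymm : ∀ s t, M s t = M t s) {X : Set S} {s t : S} {a : X} {m : ℕ} (hst : s ≠ t)
    (hm : M s t = m) (hs : retractVertex M X s = some a) (ht : retractVertex M X t = none) :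
    Even m := by
  obtain ⟨htX, ht⟩ := evenOrInf_of_retractVertex ht
  by_cases hsX : s ∈ X
  · exact ht s hsX m (hsymm s t ▸ hm)
  · by_contra hodd
    have h1 := oddLab_of_retractVertex hsX hs
    rw [hsymm] at h1
    have has : (a : S) ≠ s := fun h => hsX (h ▸ a.2)
    have h := hfree.eq_of_oddLab has hst h1
      ⟨m, hm, Nat.not_even_iff_odd.mp hodd⟩
    exact htX (h ▸ a.2)

theorem eq_of_retractVertex_of_odd (hfree : OddOddFree M) {X : Set S} {s t : S} {a b : X} {m : ℕ}
    (hst : s ≠ t) (hm : M s t = m) (hodd : Odd m) (hs : retractVertex M X s = some a)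
    (ht : retractVertex M X t = some b) (htX : t ∉ X) : a = b := by
  have hb := oddLab_of_retractVertex htX ht
  have h := hfree.eq_of_oddLab hst (fun h => htX (h ▸ b.2)) ⟨m, hm, hodd⟩ hb
  have hsb : s = b := h
  subst hsb
  rw [retractVertex_of_mem] at hs
  exact (Option.some_injective _ hs).symm

theorem altProd_retractVertex_comm (hsymm : ∀ s t, M s t = M t s) (hdiag : ∀ s, M s s = 1)
    (hge2 : ∀ s t, s ≠ t → 2 ≤ M s t) (hfree : OddOddFree M) {X : Set S}
    {ρ : ArtinGroup M →* ArtinGroup M} (hρ : IsOrdinaryRetraction M X ρ) {s t : S} {m : ℕ}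
    (hst : s ≠ t) (hm : M s t = m) :
    altProd ((retractVertex M X s).elim 1 (agen (Mres M X)))
        ((retractVertex M X t).elim 1 (agen (Mres M X))) m =
      altProd ((retractVertex M X t).elim 1 (agen (Mres M X)))
        ((retractVertex M X s).elim 1 (agen (Mres M X))) m := by
  have hm' : M t s = m := hsymm t s ▸ hm
  cases hs : retractVertex M X s with
  | none =>
    cases ht : retractVertex M X t with
    | none => rfl
    | some b =>
      exact (altProd_even_one_comm _
        (even_of_retractVertex_eq_none hfree hsymm hst.symm hm' ht hs)).symm
  | some a =>
    cases ht : retractVertex M X t with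
    | none =>
      exact altProd_even_one_comm _ (even_of_retractVertex_eq_none hfree hsymm hst hm hs ht)
    | some b =>
      simp only [Option.elim_some]
      by_cases hab : a = b
      · rw [hab]
      rcases Nat.even_or_odd m with heven | hodd
      · have hm0 : m ≠ 0 := by
          rintro rfl
          have := hge2 s t hst
          rw [hm] at this
          simp at this
        have h := congrArg ρ (altProd_agen_comm M hst hm)
        rw [map_altProd, map_altProd, hρ.apply_agen hs, hρ.apply_agen ht] at h
        obtain ⟨n, hn, hnm⟩ := label_dvd_of_altProd_agen_comm hsymm hdiag hge2
          (Subtype.coe_injective.ne hab) heven hm0 h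
        exact altProd_comm_of_dvd (altProd_agen_comm (Mres M X) hab hn) hnm
      · have htX : t ∈ X := by
          by_contra htX
          exact hab (eq_of_retractVertex_of_odd hfree hst hm hodd hs ht htX)
        have hsX : s ∈ X := by
          by_contra hsX
          exact hab (eq_of_retractVertex_of_odd hfree hst.symm hm' hodd ht hs hsX).symm
        obtain rfl : ⟨s, hsX⟩ = a := by simpa [retractVertex_of_mem (⟨s, hsX⟩ : X)] using hs
        obtain rfl : ⟨t, htX⟩ = b := by simpa [retractVertex_of_mem (⟨t, htX⟩ : X)] using ht
        exact altProd_agen_comm (Mres M X) hab hm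

theorem inducedHom_injective (hsymm : ∀ s t, M s t = M t s) (hdiag : ∀ s, M s s = 1)
    (hge2 : ∀ s t, s ≠ t → 2 ≤ M s t) (hfree : OddOddFree M)
    (hret : ∀ X : Set S, ∃ ρ, IsOrdinaryRetraction M X ρ) (X : Set S) :
    Function.Injective (inducedHom M X) := by
  obtain ⟨ρ, hρ⟩ := hret X
  let τ : ArtinGroup M →* ArtinGroup (Mres M X) :=
    PresentedGroup.toGroup
      (f := fun v => (retractVertex M X v).elim 1 (agen (Mres M X))) <| by
      rintro _ ⟨s, t, m, hst, hm, rfl⟩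
      rw [map_mul, map_inv, mul_inv_eq_one, map_altProd, map_altProd]
      simp only [FreeGroup.lift_apply_of]
      exact altProd_retractVertex_comm hsymm hdiag hge2 hfree hρ hst hm
  have hτ : τ.comp (inducedHom M X) = MonoidHom.id _ := by
    refine ArtinGroup.hom_ext fun s => ?_
    rw [MonoidHom.comp_apply, inducedHom_agen]
    refine (PresentedGroup.toGroup.of _).trans ?_
    simp [retractVertex_of_mem]
  exact Function.LeftInverse.injective (g := τ) fun x => DFunLike.congr_fun hτ x

end Retractions

section Conjugates

variable {G : Type*} [Group G]

theorem mem_conjSub {g x : G} {H : Subgroup G} : x ∈ conjSub g H ↔ g⁻¹ * x * g ∈ H := by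
  rw [conjSub, Subgroup.mem_map]
  constructor
  · rintro ⟨y, hy, rfl⟩
    simpa [mul_assoc] using hy
  · intro h
    exact ⟨_, h, by simp [mul_assoc]⟩

theorem conjSub_conjSub (g h : G) (H : Subgroup G) :
    conjSub g (conjSub h H) = conjSub (g * h) H := by
  ext x; simp only [mem_conjSub, mul_inv_rev, mul_assoc]

theorem conjSub_one (H : Subgroup G) : conjSub 1 H = H := by
  ext x; simp [mem_conjSub]

theorem conjSub_inf (g : G) (H K : Subgroup G) :
    conjSub g (H ⊓ K) = conjSub g H ⊓ conjSub g K := by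
  ext x; simp [mem_conjSub, Subgroup.mem_inf]

theorem conjSub_mono (g : G) {H K : Subgroup G} (h : H ≤ K) : conjSub g H ≤ conjSub g K :=
  Subgroup.map_mono h

theorem conjSub_of_mem {g : G} {H : Subgroup G} (hg : g ∈ H) : conjSub g H = H := by
  ext x
  rw [mem_conjSub, H.mul_mem_cancel_right hg, H.mul_mem_cancel_left (H.inv_mem hg)]

theorem conjSub_le_of_mem {g : G} {H K : Subgroup G} (hg : g ∈ K) (h : H ≤ K) :
    conjSub g H ≤ K :=
  (conjSub_mono g h).trans (conjSub_of_mem hg).le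

theorem map_conjSub {G' : Type*} [Group G'] (f : G →* G') (g : G) (H : Subgroup G) :
    (conjSub g H).map f = conjSub (f g) (H.map f) := by
  rw [conjSub, conjSub, Subgroup.map_map, Subgroup.map_map]
  congr 1
  ext x
  simp

theorem inf_conjSub_mul (P Q : Subgroup G) (a k : G) :
    P ⊓ conjSub (a * k) Q = conjSub a (conjSub a⁻¹ P ⊓ conjSub k Q) := by
  rw [conjSub_inf, conjSub_conjSub, conjSub_conjSub, mul_inv_cancel, conjSub_one]

theorem conjSub_inf_conjSub (P Q : Subgroup G) (d k : G) :
    conjSub d P ⊓ conjSub k Q = conjSub d (P ⊓ conjSub (d⁻¹ * k) Q) := by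
  rw [conjSub_inf, conjSub_conjSub, mul_inv_cancel_left]

end Conjugates

section AlternatingWords

variable {G : Type*} [Group G]

/-- `AltWord A B i j k` says that `k` is a nonempty product of factors taken alternately from
`A i` and `A (!i)`, none of them in `B`, the first one in `A i` and the last one in `A j`. -/
inductive AltWord (A : Bool → Subgroup G) (B : Subgroup G) : Bool → Bool → G → Prop
  | single {i : Bool} {a : G} : a ∈ A i → a ∉ B → AltWord A B i i a
  | cons {i j : Bool} {a k : G} : a ∈ A i → a ∉ B → AltWord A B (!i) j k →
      AltWord A B i j (a * k)

namespace AltWord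

variable {A : Bool → Subgroup G} {B : Subgroup G}

theorem append {i j m : Bool} {k l : G} (hk : AltWord A B i j k) (hl : AltWord A B (!j) m l) :
    AltWord A B i m (k * l) := by
  induction hk with
  | single ha hB => exact cons ha hB hl
  | cons ha hB _ ih => rw [mul_assoc]; exact cons ha hB (ih hl)

theorem inv {i j : Bool} {k : G} (hk : AltWord A B i j k) : AltWord A B j i k⁻¹ := by
  induction hk with
  | single ha hB => exact single (inv_mem ha) (by rwa [inv_mem_iff])
  | cons ha hB _ ih =>
    rw [mul_inv_rev]
    exact ih.append (by rw [Bool.not_not]; exact single (inv_mem ha) (by rwa [inv_mem_iff]))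

theorem base_mul (hBA : ∀ i, B ≤ A i) {i j : Bool} {b k : G} (hb : b ∈ B)
    (hk : AltWord A B i j k) : AltWord A B i j (b * k) := by
  cases hk with
  | single ha hB =>
    exact single (mul_mem (hBA _ hb) ha) (by rwa [B.mul_mem_cancel_left hb])
  | cons ha hB hk =>
    rw [← mul_assoc]
    exact cons (mul_mem (hBA _ hb) ha) (by rwa [B.mul_mem_cancel_left hb]) hk

theorem notMem_base (hBA : ∀ i, B ≤ A i) (hne : ∀ i j, ¬ AltWord A B i j 1) {i j : Bool} {k : G}
    (hk : AltWord A B i j k) : k ∉ B := fun hkB =>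
  hne i j (by simpa using hk.base_mul hBA (inv_mem hkB))

theorem mul_right (hBA : ∀ i, B ≤ A i) {i j n : Bool} {k y : G} (hk : AltWord A B i j k)
    (hy : y ∈ A n) : k * y ∈ B ∨ ∃ p, AltWord A B i p (k * y) := by
  induction hk with
  | @single i a ha hB =>
    by_cases hyB : y ∈ B
    · exact Or.inr ⟨i, single (mul_mem ha (hBA _ hyB)) (by rwa [B.mul_mem_cancel_right hyB])⟩
    by_cases hin : n = i
    · subst hin
      by_cases h : a * y ∈ B
      · exact Or.inl h
      · exact Or.inr ⟨n, single (mul_mem ha hy) h⟩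
    · obtain rfl : n = !i := Bool.eq_not_of_ne hin
      exact Or.inr ⟨_, cons ha hB (single hy hyB)⟩
  | @cons i j a k ha hB _ ih =>
    rw [mul_assoc]
    rcases ih with h | ⟨p, h⟩
    · exact Or.inr ⟨i, single (mul_mem ha (hBA _ h)) (by rwa [B.mul_mem_cancel_right h])⟩
    · exact Or.inr ⟨p, cons ha hB h⟩

theorem base_or_exists_of_mem_closure (hBA : ∀ i, B ≤ A i) {T : Set G}
    (hT : ∀ x ∈ T, ∃ i, x ∈ A i) {k : G} (hk : k ∈ Subgroup.closure T) :
    k ∈ B ∨ ∃ i j, AltWord A B i j k := by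
  have step (x y : G) (n : Bool) (hy : y ∈ A n) (hx : x ∈ B ∨ ∃ i j, AltWord A B i j x) :
      x * y ∈ B ∨ ∃ i j, AltWord A B i j (x * y) := by
    rcases hx with hx | ⟨i, j, hx⟩
    · by_cases h : x * y ∈ B
      · exact Or.inl h
      · exact Or.inr ⟨n, n, single (mul_mem (hBA n hx) hy) h⟩
    · rcases hx.mul_right hBA hy with h | ⟨p, h⟩
      · exact Or.inl h
      · exact Or.inr ⟨i, p, h⟩
  induction hk using Subgroup.closure_induction_right with
  | one => exact Or.inl (one_mem B)
  | mul_right x hx y hy ih =>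
    obtain ⟨n, hn⟩ := hT y hy
    exact step x y n hn ih
  | mul_inv_cancel x hx y hy ih =>
    obtain ⟨n, hn⟩ := hT y hy
    exact step x _ n (inv_mem hn) ih

theorem inf_conjSub_le_base (hBA : ∀ i, B ≤ A i) (hne : ∀ i j, ¬ AltWord A B i j 1)
    {l m i j : Bool} {k : G} (hk : AltWord A B l m k) (hil : i ≠ l) :
    A i ⊓ conjSub k (A j) ≤ B := by
  rintro x ⟨hx, hxk⟩
  obtain rfl : l = !i := Bool.eq_not_of_ne hil.symm
  by_contra hxB
  have hxk' : AltWord A B i m (x * k) := cons hx hxB hk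
  have he : x * k = k * (k⁻¹ * x * k) := by group
  rcases hk.mul_right hBA (mem_conjSub.mp hxk) with h | ⟨p, h⟩
  · exact hxk'.notMem_base hBA hne (he ▸ h)
  · rw [← he] at h
    have h1 : AltWord A B p m ((x * k)⁻¹ * (x * k)) := h.inv.append (by rwa [Bool.not_not])
    rw [inv_mul_cancel] at h1
    exact hne p m h1

theorem inf_le_base (hne : ∀ i j, ¬ AltWord A B i j 1) {i j : Bool} (hij : i ≠ j) :
    A i ⊓ A j ≤ B := by
  rintro x ⟨hi, hj⟩
  obtain rfl : j = !i := Bool.eq_not_of_ne hij.symm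
  by_contra hB
  have h : AltWord A B i (!i) (x * x⁻¹) :=
    (single hi hB).append (single (inv_mem hj) (by rwa [inv_mem_iff]))
  rw [mul_inv_cancel] at h
  exact hne _ _ h

end AltWord

variable {A : Bool → Subgroup G} {B : Subgroup G} {Par : Subgroup G → Prop}

/-- A class of subgroups of an amalgamated product that is closed under conjugation, contains
the amalgamated subgroup, and is closed under intersections inside each factor, is closed under
intersections of conjugates of subgroups of the factors. -/
theorem par_inf_conjSub_of_amalgam (hBA : ∀ i, B ≤ A i) (hne : ∀ i j, ¬ AltWord A B i j 1)
    (hconj : ∀ g P, Par P → Par (conjSub g P)) (hB : Par B)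
    (hint : ∀ i P Q, Par P → Par Q → P ≤ A i → Q ≤ A i → Par (P ⊓ Q))
    {k : G} (hk : k ∈ B ∨ ∃ l m, AltWord A B l m k) {i j : Bool} {P Q : Subgroup G}
    (hP : Par P) (hQ : Par Q) (hPi : P ≤ A i) (hQj : Q ≤ A j) : Par (P ⊓ conjSub k Q) := by
  have hbase (i j : Bool) (P Q : Subgroup G) (hP : Par P) (hQ : Par Q) (hPi : P ≤ A i)
      (hQj : Q ≤ A j) : Par (P ⊓ Q) := by
    by_cases hij : i = j
    · subst hij
      exact hint i P Q hP hQ hPi hQj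
    have h : P ⊓ Q = (P ⊓ B) ⊓ Q := by
      refine le_antisymm (le_inf (le_inf inf_le_left ?_) inf_le_right)
        (inf_le_inf_right _ inf_le_left)
      exact (inf_le_inf hPi hQj).trans (AltWord.inf_le_base hne hij)
    rw [h]
    exact hint j _ _ (hint i P B hP hB hPi (hBA i)) hQ (inf_le_right.trans (hBA j)) hQj
  have hstep (l : Bool) (a k : G) (ha : a ∈ A l)
      (hk : ∀ P, Par P → P ≤ A l → Par (P ⊓ conjSub k Q)) (i : Bool)
      (hle : i ≠ l → A i ⊓ conjSub (a * k) (A j) ≤ B) (P : Subgroup G) (hP : Par P)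
      (hPi : P ≤ A i) : Par (P ⊓ conjSub (a * k) Q) := by
    have haux (P : Subgroup G) (hP : Par P) (hPl : P ≤ A l) : Par (P ⊓ conjSub (a * k) Q) := by
      rw [inf_conjSub_mul]
      exact hconj _ _ (hk _ (hconj _ _ hP) (conjSub_le_of_mem (inv_mem ha) hPl))
    by_cases hil : i = l
    · subst hil
      exact haux P hP hPi
    have h : P ⊓ conjSub (a * k) Q = (P ⊓ B) ⊓ conjSub (a * k) Q := by
      refine le_antisymm (le_inf (le_inf inf_le_left ?_) inf_le_right)
        (inf_le_inf_right _ inf_le_left)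
      exact (inf_le_inf hPi (conjSub_mono _ hQj)).trans (hle hil)
    rw [h]
    exact haux _ (hint i P B hP hB hPi (hBA i)) (inf_le_right.trans (hBA l))
  rcases hk with hk | ⟨l, m, hk⟩
  · exact hbase i j P _ hP (hconj _ _ hQ) hPi (conjSub_le_of_mem (hBA j hk) hQj)
  · induction hk generalizing i P with
    | @single l a ha haB =>
      have h := hstep l a 1 ha
        (fun P hP hPl => by rw [conjSub_one]; exact hbase l j P Q hP hQ hPl hQj) i
        (fun hil => by
          rw [mul_one]; exact (AltWord.single ha haB).inf_conjSub_le_base hBA hne hil) P hP hPi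
      rwa [mul_one] at h
    | @cons l m a k ha haB hk ih =>
      exact hstep l a k ha (fun P hP hPl => ih hP hPl) i
        (fun hil => (AltWord.cons ha haB hk).inf_conjSub_le_base hBA hne hil) P hP hPi

end AlternatingWords

section Amalgam

open Monoid

variable {S : Type*} {M : S → S → ℕ∞}

/-- The map between Artin groups of nested induced subgraphs. -/
def inducedHomOfLE (M : S → S → ℕ∞) {X Y : Set S} (h : X ⊆ Y) :
    ArtinGroup (Mres M X) →* ArtinGroup (Mres M Y) :=
  ArtinGroup.map (Set.inclusion h) (Set.inclusion_injective h) fun _ _ => rfl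

theorem inducedHomOfLE_agen (M : S → S → ℕ∞) {X Y : Set S} (h : X ⊆ Y) (s : X) :
    inducedHomOfLE M h (agen (Mres M X) s) = agen (Mres M Y) (Set.inclusion h s) :=
  ArtinGroup.map_agen _ _ _ s

theorem inducedHom_inducedHomOfLE (M : S → S → ℕ∞) {X Y : Set S} (h : X ⊆ Y)
    (x : ArtinGroup (Mres M X)) : inducedHom M Y (inducedHomOfLE M h x) = inducedHom M X x := by
  have : (inducedHom M Y).comp (inducedHomOfLE M h) = inducedHom M X :=
    ArtinGroup.hom_ext fun s => by
      rw [MonoidHom.comp_apply, inducedHomOfLE_agen, inducedHom_agen, inducedHom_agen]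
  exact DFunLike.congr_fun this x

theorem exists_hom_pushout {W : Bool → Set S} {I Z : Set S} (hIW : ∀ i, I ⊆ W i)
    (hWI : ∀ i j, i ≠ j → W i ∩ W j ⊆ I) (hWZ : ∀ i, W i ⊆ Z) (hZ : ∀ s ∈ Z, ∃ i, s ∈ W i)
    (hedge : ∀ s ∈ Z, ∀ t ∈ Z, M s t ≠ ⊤ → ∃ i, s ∈ W i ∧ t ∈ W i) :
    ∃ ψ : ArtinGroup (Mres M Z) →* PushoutI fun i => inducedHomOfLE M (hIW i),
      ∀ i x, ψ (inducedHomOfLE M (hWZ i) x) = PushoutI.of i x := by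
  choose c hc using hZ
  let f (s : Z) : PushoutI fun i => inducedHomOfLE M (hIW i) :=
    PushoutI.of (c s s.2) (agen (Mres M (W (c s s.2))) ⟨s, hc s s.2⟩)
  have hf (i : Bool) (s : Z) (hs : s.1 ∈ W i) :
      f s = PushoutI.of i (agen (Mres M (W i)) ⟨s, hs⟩) := by
    by_cases h : c s s.2 = i
    · subst h; rfl
    have hI : s.1 ∈ I := hWI _ _ h ⟨hc s s.2, hs⟩
    have h1 (j : Bool) := PushoutI.of_apply_eq_base (fun i => inducedHomOfLE M (hIW i)) j
      (agen (Mres M I) ⟨s, hI⟩)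
    simp only [inducedHomOfLE_agen] at h1
    exact (h1 _).trans (h1 i).symm
  have hrel : ∀ r ∈ ArtinRels (Mres M Z), FreeGroup.lift f r = 1 := by
    rintro _ ⟨s, t, m, hst, hm, rfl⟩
    rw [map_mul, map_inv, mul_inv_eq_one, map_altProd, map_altProd]
    simp only [FreeGroup.lift_apply_of]
    obtain ⟨i, hs, ht⟩ := hedge s s.2 t t.2 (by
      have : M s t = m := hm
      simp [this])
    rw [hf i s hs, hf i t ht, ← map_altProd, ← map_altProd]
    congr 1
    exact altProd_agen_comm (Mres M (W i)) (fun h => hst (Subtype.ext (Subtype.mk.inj h))) hm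
  have hcomp (i : Bool) : (PresentedGroup.toGroup hrel).comp (inducedHomOfLE M (hWZ i)) =
      PushoutI.of (φ := fun i => inducedHomOfLE M (hIW i)) i := ArtinGroup.hom_ext fun s => by
    rw [MonoidHom.comp_apply, inducedHomOfLE_agen]
    exact (PresentedGroup.toGroup.of _).trans (hf i (Set.inclusion (hWZ i) s) s.2)
  exact ⟨PresentedGroup.toGroup hrel, fun i x => DFunLike.congr_fun (hcomp i) x⟩

theorem not_altWord_one {W : Bool → Set S} {I Z : Set S} (hIW : ∀ i, I ⊆ W i)
    (hWI : ∀ i j, i ≠ j → W i ∩ W j ⊆ I) (hWZ : ∀ i, W i ⊆ Z) (hZ : ∀ s ∈ Z, ∃ i, s ∈ W i)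
    (hedge : ∀ s ∈ Z, ∀ t ∈ Z, M s t ≠ ⊤ → ∃ i, s ∈ W i ∧ t ∈ W i)
    (hinj : ∀ X : Set S, Function.Injective (inducedHom M X)) (i j : Bool) :
    ¬ AltWord (fun i => parabolic M (W i)) (parabolic M I) i j 1 := by
  obtain ⟨ψ, hψ⟩ := exists_hom_pushout hIW hWI hWZ hZ hedge
  have hletter (i : Bool) (a : ArtinGroup M) (ha : a ∈ parabolic M (W i))
      (hI : a ∉ parabolic M I) : ∃ x : ArtinGroup (Mres M (W i)),
        inducedHom M Z (inducedHomOfLE M (hWZ i) x) = a ∧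
          x ∉ (inducedHomOfLE M (hIW i)).range := by
    rw [← range_inducedHom] at ha
    obtain ⟨x, rfl⟩ := ha
    refine ⟨x, inducedHom_inducedHomOfLE M (hWZ i) x, ?_⟩
    rintro ⟨y, rfl⟩
    rw [inducedHom_inducedHomOfLE, ← range_inducedHom] at hI
    exact hI ⟨y, rfl⟩
  have hword (i j : Bool) (k : ArtinGroup M)
      (hk : AltWord (fun i => parabolic M (W i)) (parabolic M I) i j k) :
      ∃ (w : CoprodI.Word fun i => ArtinGroup (Mres M (W i))) (x : ArtinGroup (Mres M Z)),
        PushoutI.Reduced (fun i => inducedHomOfLE M (hIW i)) w ∧ w.fstIdx = some i ∧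
          inducedHom M Z x = k ∧ ψ x = PushoutI.ofCoprodI w.prod := by
    induction hk with
    | @single i a ha hI =>
      obtain ⟨x, hx, hxI⟩ := hletter i a ha hI
      have hx1 : x ≠ 1 := by rintro rfl; exact hxI (one_mem _)
      have h0 : (CoprodI.Word.empty (M := fun i => ArtinGroup (Mres M (W i)))).fstIdx ≠ some i := by
        simp [CoprodI.Word.fstIdx, CoprodI.Word.empty]
      refine ⟨CoprodI.Word.cons x .empty h0 hx1, _, ?_, ?_, hx, ?_⟩
      · intro g hg
        simp only [CoprodI.Word.cons, CoprodI.Word.empty, List.mem_singleton] at hg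
        rw [hg]; exact hxI
      · simp [CoprodI.Word.cons, CoprodI.Word.fstIdx]
      · rw [hψ, CoprodI.Word.prod_cons]; simp
    | @cons i j a k ha hI _ ih =>
      obtain ⟨w, y, hw, hwi, hy, hyw⟩ := ih
      obtain ⟨x, hx, hxI⟩ := hletter i a ha hI
      have hx1 : x ≠ 1 := by rintro rfl; exact hxI (one_mem _)
      refine ⟨CoprodI.Word.cons x w (by rw [hwi]; simp) hx1,
        inducedHomOfLE M (hWZ i) x * y, ?_, ?_, ?_, ?_⟩
      · intro g hg
        simp only [CoprodI.Word.cons, List.mem_cons] at hg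
        rcases hg with rfl | hg
        · exact hxI
        · exact hw g hg
      · simp [CoprodI.Word.cons, CoprodI.Word.fstIdx]
      · rw [map_mul, hx, hy]
      · rw [map_mul, hψ, hyw, CoprodI.Word.prod_cons, map_mul]; simp
  intro h
  obtain ⟨w, x, hw, hwi, hx, hxw⟩ := hword i j 1 h
  obtain rfl : x = 1 := hinj Z (by rw [hx, map_one])
  have hφ (i : Bool) : Function.Injective (inducedHomOfLE M (hIW i)) := fun x y hxy =>
    hinj I (by rw [← inducedHom_inducedHomOfLE M (hIW i), hxy, inducedHom_inducedHomOfLE])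
  rw [map_one] at hxw
  rw [hw.eq_empty_of_mem_range hφ (hxw ▸ one_mem _)] at hwi
  simp [CoprodI.Word.fstIdx, CoprodI.Word.empty] at hwi

end Amalgam

section Parabolic

variable {S : Type*} {M : S → S → ℕ∞}

/-- A parabolic subgroup: a conjugate of a standard parabolic subgroup. -/
def IsParabolic (M : S → S → ℕ∞) (P : Subgroup (ArtinGroup M)) : Prop :=
  ∃ (g : ArtinGroup M) (X : Set S), P = conjSub g (parabolic M X)

theorem isParabolic_parabolic (X : Set S) : IsParabolic M (parabolic M X) :=
  ⟨1, X, (conjSub_one _).symm⟩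

theorem IsParabolic.conj {P : Subgroup (ArtinGroup M)} (g : ArtinGroup M) (hP : IsParabolic M P) :
    IsParabolic M (conjSub g P) := by
  obtain ⟨u, X, rfl⟩ := hP
  exact ⟨g * u, X, conjSub_conjSub _ _ _⟩

theorem Cset_subset (X Y : Set S) : Cset M X Y ⊆ X := by
  rintro x (⟨hx, -⟩ | ⟨⟨hx, -⟩, -⟩) <;> exact hx

theorem IsRetraction.map_eq_self {G : Type*} [Group G] {ρ : G →* G} {H K : Subgroup G}
    (hρ : IsRetraction ρ H) (hK : K ≤ H) : K.map ρ = K := by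
  ext x
  constructor
  · rintro ⟨y, hy, rfl⟩
    rwa [hρ.2 y (hK hy)]
  · exact fun hx => ⟨x, hx, hρ.2 x (hK hx)⟩

theorem IsParabolic.exists_of_le (hsymm : ∀ s t, M s t = M t s)
    (hret : ∀ X : Set S, ∃ ρ, IsOrdinaryRetraction M X ρ) {P : Subgroup (ArtinGroup M)}
    (hP : IsParabolic M P) {d : ArtinGroup M} {H : Set S}
    (hPH : P ≤ conjSub d (parabolic M H)) :
    ∃ v ∈ parabolic M H, ∃ K ⊆ H, P = conjSub (d * v) (parabolic M K) := by
  obtain ⟨u, X, rfl⟩ := hP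
  obtain ⟨ρ, hρ⟩ := hret H
  refine ⟨ρ (d⁻¹ * u), hρ.1.1 _, Cset M H X, Cset_subset _ _, ?_⟩
  have h1 : conjSub (d⁻¹ * u) (parabolic M X) ≤ parabolic M H := by
    have := conjSub_mono d⁻¹ hPH
    rwa [conjSub_conjSub, conjSub_conjSub, inv_mul_cancel, conjSub_one] at this
  have h2 := hρ.1.map_eq_self h1
  rw [map_conjSub, hρ.map_parabolic hsymm] at h2
  rw [← conjSub_conjSub, h2, conjSub_conjSub, mul_inv_cancel_left]

theorem inf_conjSub_le_conjSub_Cset (hsymm : ∀ s t, M s t = M t s)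
    (hret : ∀ X : Set S, ∃ ρ, IsOrdinaryRetraction M X ρ) (X Y : Set S) (g : ArtinGroup M) :
    ∃ a ∈ parabolic M X, parabolic M X ⊓ conjSub g (parabolic M Y) ≤
      conjSub a (parabolic M (Cset M X Y)) := by
  obtain ⟨ρ, hρ⟩ := hret X
  refine ⟨ρ g, hρ.1.1 g, ?_⟩
  rintro x ⟨hx, hxg⟩
  rw [← hρ.map_parabolic hsymm, ← map_conjSub]
  exact ⟨x, hxg, hρ.1.2 x hx⟩

theorem exists_inf_conjSub_eq (hsymm : ∀ s t, M s t = M t s)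
    (hret : ∀ X : Set S, ∃ ρ, IsOrdinaryRetraction M X ρ) (X Y : Set S) (g : ArtinGroup M) :
    ∃ a ∈ parabolic M X, ∃ b ∈ parabolic M Y,
      parabolic M X ⊓ conjSub g (parabolic M Y) =
        conjSub a (parabolic M (Cset M X Y) ⊓
          conjSub (a⁻¹ * g * b) (parabolic M (Cset M Y X))) := by
  obtain ⟨a, ha, hXY⟩ := inf_conjSub_le_conjSub_Cset hsymm hret X Y g
  obtain ⟨b, hb, hYX⟩ := inf_conjSub_le_conjSub_Cset hsymm hret Y X g⁻¹
  refine ⟨a, ha, b, hb, ?_⟩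
  have hYX' : parabolic M X ⊓ conjSub g (parabolic M Y) ≤
      conjSub (g * b) (parabolic M (Cset M Y X)) := by
    have := conjSub_mono g hYX
    rwa [conjSub_inf, conjSub_conjSub, conjSub_conjSub, mul_inv_cancel, conjSub_one,
      inf_comm] at this
  rw [conjSub_inf, conjSub_conjSub, mul_assoc, mul_inv_cancel_left]
  refine le_antisymm (le_inf hXY hYX') (inf_le_inf ?_ ?_)
  · exact conjSub_le_of_mem ha (parabolic_mono M (Cset_subset _ _))
  · rw [← conjSub_conjSub]
    exact conjSub_mono g (conjSub_le_of_mem hb (parabolic_mono M (Cset_subset _ _)))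

theorem ncard_Cset_le [Finite S] (hsymm : ∀ s t, M s t = M t s) (hfree : OddOddFree M)
    (X Y : Set S) : (Cset M X Y).ncard ≤ (Cset M Y X).ncard := by
  have hdisj (X Y : Set S) : Disjoint (X ∩ Y) (Oset M X Y) :=
    Set.disjoint_left.mpr fun x hx hx' => hx'.1.2 hx.2
  rw [Cset, Cset, Set.ncard_union_eq (hdisj X Y), Set.ncard_union_eq (hdisj Y X), Set.inter_comm Y X]
  refine Nat.add_le_add_left ?_ _
  have h (x : S) (hx : x ∈ Oset M X Y) : ∃ y, y ∈ Y \ X ∧ OddLab (M x y) := hx.2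
  choose! f hf using h
  refine Set.ncard_le_ncard_of_injOn f (fun x hx => ?_) (fun x hx x' hx' hxx' => ?_)
  · exact ⟨(hf x hx).1, x, hx.1, hsymm x (f x) ▸ (hf x hx).2⟩
  · refine hfree.eq_of_oddLab (t := f x) ?_ ?_ (hf x hx).2 ?_
    · exact fun h => (hf x hx).1.2 (h ▸ hx.1.1)
    · exact fun h => (hf x hx).1.2 (h ▸ hx'.1.1)
    · rw [hsymm, hxx']; exact (hf x' hx').2

theorem ncard_Cset_comm [Finite S] (hsymm : ∀ s t, M s t = M t s) (hfree : OddOddFree M)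
    (X Y : Set S) : (Cset M X Y).ncard = (Cset M Y X).ncard :=
  le_antisymm (ncard_Cset_le hsymm hfree X Y) (ncard_Cset_le hsymm hfree Y X)

theorem Cset_Mres {Y Z : Set S} (X : Set S) (hY : Y ⊆ Z) :
    Cset (Mres M Z) (Subtype.val ⁻¹' X) (Subtype.val ⁻¹' Y) = Subtype.val ⁻¹' Cset M X Y := by
  ext ⟨s, hs⟩
  simp only [Cset, Oset, Mres, Set.mem_union, Set.mem_inter_iff, Set.mem_preimage,
    Set.mem_ofPred_eq, Set.mem_sdiff, Subtype.exists]
  grind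

end Parabolic

section Intersections

variable {S : Type*} {M : S → S → ℕ∞}

theorem parabolic_Cset_eq_or_inf_le
    (hinj : ∀ X : Set S, Function.Injective (inducedHom M X)) {Z : Set S}
    (hC : ∀ (X Y : Set Z) (g : ArtinGroup (Mres M Z)),
      (∀ z : Z, z ∉ Cset (Mres M Z) X Y ∪ Cset (Mres M Z) Y X →
        ∀ t : Z, Mres M Z z t ≠ ⊤) →
      (parabolic (Mres M Z) (Cset (Mres M Z) X Y) =
          conjSub g (parabolic (Mres M Z) (Cset (Mres M Z) Y X)) ∨
        ∃ (d : ArtinGroup (Mres M Z)) (H : Set Z),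
          (H ⊂ Cset (Mres M Z) X Y ∨ H ⊂ Cset (Mres M Z) Y X) ∧
          parabolic (Mres M Z) (Cset (Mres M Z) X Y) ⊓
              conjSub g (parabolic (Mres M Z) (Cset (Mres M Z) Y X)) ≤
            conjSub d (parabolic (Mres M Z) H)))
    {X Y : Set S} (hX : X ⊆ Z) (hY : Y ⊆ Z) {g : ArtinGroup M} (hg : g ∈ parabolic M Z)
    (hstar : ∀ z ∈ Z, z ∉ Cset M X Y ∪ Cset M Y X → ∀ t ∈ Z, M z t ≠ ⊤) :
    parabolic M (Cset M X Y) = conjSub g (parabolic M (Cset M Y X)) ∨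
      ∃ d ∈ parabolic M Z, ∃ H ⊆ Z, (H ⊂ Cset M X Y ∨ H ⊂ Cset M Y X) ∧
        parabolic M (Cset M X Y) ⊓ conjSub g (parabolic M (Cset M Y X)) ≤
          conjSub d (parabolic M H) := by
  rw [← range_inducedHom] at hg
  obtain ⟨g, rfl⟩ := hg
  have hval {X Y : Set S} (hX : X ⊆ Z) :
      Subtype.val '' (Subtype.val ⁻¹' Cset M X Y : Set Z) = Cset M X Y := by
    rw [Subtype.image_preimage_coe, Set.inter_eq_right]
    exact (Cset_subset X Y).trans hX
  have h := hC (Subtype.val ⁻¹' X) (Subtype.val ⁻¹' Y) g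
  rw [Cset_Mres X hY, Cset_Mres Y hX] at h
  obtain h | ⟨d, H, hH, hle⟩ := h fun z hz t => hstar z z.2 hz t t.2
  · left
    have := congrArg (Subgroup.map (inducedHom M Z)) h
    rwa [map_conjSub, map_inducedHom_parabolic, map_inducedHom_parabolic, hval hX, hval hY]
      at this
  · right
    refine ⟨inducedHom M Z d, range_inducedHom M Z ▸ ⟨d, rfl⟩, Subtype.val '' H, by simp, ?_, ?_⟩
    · rw [← hval (Y := Y) hX, ← hval (Y := X) hY]
      exact hH.imp (Subtype.val_injective.image_strictMono ·)
        (Subtype.val_injective.image_strictMono ·)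
    · have := Subgroup.map_mono (f := inducedHom M Z) hle
      rwa [Subgroup.map_inf _ _ _ (hinj Z), map_conjSub, map_conjSub, map_inducedHom_parabolic,
        map_inducedHom_parabolic, map_inducedHom_parabolic, hval hX, hval hY] at this

theorem isParabolic_inf_conjSub_of_eq_top (hsymm : ∀ s t, M s t = M t s)
    (hdiag : ∀ s, M s s = 1) (hinj : ∀ X : Set S, Function.Injective (inducedHom M X))
    {Z : Set S}
    (hint : ∀ W ⊂ Z, ∀ P Q, IsParabolic M P → IsParabolic M Q → P ≤ parabolic M W →
      Q ≤ parabolic M W → IsParabolic M (P ⊓ Q))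
    {z t : S} (hz : z ∈ Z) (ht : t ∈ Z) (hzt : M z t = ⊤) {X Y : Set S} (hX : X ⊆ Z \ {z})
    (hY : Y ⊆ Z \ {z}) {k : ArtinGroup M} (hk : k ∈ parabolic M Z) :
    IsParabolic M (parabolic M X ⊓ conjSub k (parabolic M Y)) := by
  let L : Set S := {s ∈ Z | M z s ≠ ⊤}
  let W (i : Bool) : Set S := cond i L (Z \ {z})
  have hzL : z ∈ L := ⟨hz, by simp [hdiag]⟩
  have hIW (i : Bool) : L \ {z} ⊆ W i := by
    cases i
    · exact Set.sdiff_subset_sdiff_left fun s hs => hs.1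
    · exact Set.sdiff_subset
  have hWI (i j : Bool) (hij : i ≠ j) : W i ∩ W j ⊆ L \ {z} := by
    cases i <;> cases j
    · exact absurd rfl hij
    · exact fun s hs => ⟨hs.2, hs.1.2⟩
    · exact fun s hs => ⟨hs.1, hs.2.2⟩
    · exact absurd rfl hij
  have hWZ (i : Bool) : W i ⊂ Z := by
    cases i
    · exact ⟨Set.sdiff_subset, fun h => (h hz).2 rfl⟩
    · exact ⟨fun s hs => hs.1, fun h => (h ht).2 hzt⟩
  have hedge (s : S) (hs : s ∈ Z) (u : S) (hu : u ∈ Z) (hsu : M s u ≠ ⊤) :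
      ∃ i, s ∈ W i ∧ u ∈ W i := by
    by_cases hsz : s = z
    · subst hsz
      exact ⟨true, hzL, hu, hsu⟩
    by_cases huz : u = z
    · subst huz
      exact ⟨true, ⟨hs, hsymm s u ▸ hsu⟩, hzL⟩
    · exact ⟨false, ⟨hs, hsz⟩, hu, huz⟩
  have hcover (s : S) (hs : s ∈ Z) : ∃ i, s ∈ W i := by
    obtain ⟨i, hi, -⟩ := hedge s hs s hs (by simp [hdiag])
    exact ⟨i, hi⟩
  have hBA (i : Bool) : parabolic M (L \ {z}) ≤ parabolic M (W i) := parabolic_mono M (hIW i)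
  refine par_inf_conjSub_of_amalgam (A := fun i => parabolic M (W i)) (i := false) (j := false)
    hBA (not_altWord_one hIW hWI (fun i => (hWZ i).subset) hcover hedge hinj)
    (fun g P hP => hP.conj g) (isParabolic_parabolic _) (fun i P Q => hint (W i) (hWZ i) P Q)
    (AltWord.base_or_exists_of_mem_closure hBA ?_ hk) (isParabolic_parabolic X)
    (isParabolic_parabolic Y) (parabolic_mono M hX) (parabolic_mono M hY)
  rintro _ ⟨s, hs, rfl⟩
  obtain ⟨i, hi⟩ := hcover s hs
  exact ⟨i, agen_mem_parabolic hi⟩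

theorem isParabolic_parabolic_inf_conjSub [Finite S] (hsymm : ∀ s t, M s t = M t s)
    (hdiag : ∀ s, M s s = 1) (hfree : OddOddFree M)
    (hret : ∀ X : Set S, ∃ ρ, IsOrdinaryRetraction M X ρ)
    (hinj : ∀ X : Set S, Function.Injective (inducedHom M X)) {Z : Set S}
    (hint : ∀ W ⊂ Z, ∀ P Q, IsParabolic M P → IsParabolic M Q → P ≤ parabolic M W →
      Q ≤ parabolic M W → IsParabolic M (P ⊓ Q))
    (hC : ∀ X ⊆ Z, ∀ Y ⊆ Z, ∀ g ∈ parabolic M Z,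
      (∀ z ∈ Z, z ∉ Cset M X Y ∪ Cset M Y X → ∀ t ∈ Z, M z t ≠ ⊤) →
      (parabolic M (Cset M X Y) = conjSub g (parabolic M (Cset M Y X)) ∨
        ∃ d ∈ parabolic M Z, ∃ H ⊆ Z, (H ⊂ Cset M X Y ∨ H ⊂ Cset M Y X) ∧
          parabolic M (Cset M X Y) ⊓ conjSub g (parabolic M (Cset M Y X)) ≤
            conjSub d (parabolic M H)))
    (X Y : Set S) (hX : X ⊆ Z) (hY : Y ⊆ Z) (g : ArtinGroup M) (hg : g ∈ parabolic M Z) :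
    IsParabolic M (parabolic M X ⊓ conjSub g (parabolic M Y)) := by
  induction hN : X.ncard + Y.ncard using Nat.strong_induction_on generalizing X Y g with
  | _ N ih =>
  obtain ⟨a, ha, b, hb, h⟩ := exists_inf_conjSub_eq hsymm hret X Y g
  rw [h]
  refine IsParabolic.conj a ?_
  have hk : a⁻¹ * g * b ∈ parabolic M Z := mul_mem
    (mul_mem (inv_mem (parabolic_mono M hX ha)) hg) (parabolic_mono M hY hb)
  generalize a⁻¹ * g * b = k at hk
  have hCZ := (Cset_subset (M := M) X Y).trans hX
  have hDZ := (Cset_subset (M := M) Y X).trans hY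
  by_cases hstar : ∀ z ∈ Z, z ∉ Cset M X Y ∪ Cset M Y X → ∀ t ∈ Z, M z t ≠ ⊤
  · obtain heq | ⟨d, hd, H, hHZ, hHC, hle⟩ := hC X hX Y hY k hk hstar
    · rw [← heq, inf_idem]
      exact isParabolic_parabolic _
    have hCX := Set.ncard_le_ncard (Cset_subset (M := M) X Y)
    have hDY := Set.ncard_le_ncard (Cset_subset (M := M) Y X)
    have hcomm := ncard_Cset_comm hsymm hfree X Y
    have hH : H.ncard < (Cset M X Y).ncard := by
      rcases hHC with h | h
      · exact Set.ncard_lt_ncard h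
      · exact hcomm ▸ Set.ncard_lt_ncard h
    have hR : IsParabolic M (parabolic M (Cset M X Y) ⊓ conjSub d (parabolic M H)) :=
      ih _ (by omega) _ H hCZ hHZ d hd rfl
    obtain ⟨v, hv, K, hKH, hK⟩ := hR.exists_of_le hsymm hret inf_le_right
    have hKle := Set.ncard_le_ncard hKH
    rw [← inf_eq_left.mpr hle, inf_right_comm, hK, conjSub_inf_conjSub]
    refine IsParabolic.conj _ (ih _ ?_ K _ (hKH.trans hHZ) hDZ _ ?_ rfl)
    · omega
    · exact mul_mem (inv_mem (mul_mem hd (parabolic_mono M hHZ hv))) hk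
  · push Not at hstar
    obtain ⟨z, hz, hzCD, t, ht, hzt⟩ := hstar
    exact isParabolic_inf_conjSub_of_eq_top hsymm hdiag hinj hint hz ht hzt
      (fun s hs => ⟨hCZ hs, fun h => hzCD (Or.inl (h ▸ hs))⟩)
      (fun s hs => ⟨hDZ hs, fun h => hzCD (Or.inr (h ▸ hs))⟩) hk

end Intersections

/-- If `M` is (odd, odd)-free and the family of Artin groups of the restrictions of
`M` satisfies property `C` — every restriction admits ordinary retractions, and
whenever every vertex outside `C_{X,Y} ∪ C_{Y,X}` has full star, either
`A_{C_{X,Y}} = g A_{C_{Y,X}} g⁻¹` or `A_{C_{X,Y}} ∩ g A_{C_{Y,X}} g⁻¹` is contained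
in a parabolic subgroup over a proper subset of `C_{X,Y}` or `C_{Y,X}` — then the
intersection of any two parabolic subgroups of the Artin group of `M` is again a
parabolic subgroup. -/
theorem intersection_of_parabolics_is_parabolic {S : Type*} [Fintype S]
    (M : S → S → ℕ∞)
    (hsymm : ∀ s t, M s t = M t s) (hdiag : ∀ s, M s s = 1)
    (hge2 : ∀ s t, s ≠ t → 2 ≤ M s t)
    (hfree : OddOddFree M)
    (hord : ∀ (Z : Set S) (X : Set Z),
      ∃ ρ : ArtinGroup (Mres M Z) →* ArtinGroup (Mres M Z),
        IsOrdinaryRetraction (Mres M Z) X ρ)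
    (hC : ∀ (Z : Set S) (X Y : Set Z) (g : ArtinGroup (Mres M Z)),
      (∀ z : Z, z ∉ Cset (Mres M Z) X Y ∪ Cset (Mres M Z) Y X →
        ∀ t : Z, Mres M Z z t ≠ ⊤) →
      (parabolic (Mres M Z) (Cset (Mres M Z) X Y) =
          conjSub g (parabolic (Mres M Z) (Cset (Mres M Z) Y X)) ∨
        ∃ (d : ArtinGroup (Mres M Z)) (H : Set Z),
          (H ⊂ Cset (Mres M Z) X Y ∨ H ⊂ Cset (Mres M Z) Y X) ∧
          parabolic (Mres M Z) (Cset (Mres M Z) X Y) ⊓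
              conjSub g (parabolic (Mres M Z) (Cset (Mres M Z) Y X)) ≤
            conjSub d (parabolic (Mres M Z) H))) :
    ∀ P Q : Subgroup (ArtinGroup M),
      (∃ (g : ArtinGroup M) (X : Set S), P = conjSub g (parabolic M X)) →
      (∃ (g : ArtinGroup M) (X : Set S), Q = conjSub g (parabolic M X)) →
      ∃ (g : ArtinGroup M) (X : Set S), P ⊓ Q = conjSub g (parabolic M X) := by
  have hret := exists_isOrdinaryRetraction_of_univ (hord Set.univ)
  have hinj := inducedHom_injective hsymm hdiag hge2 hfree hret
  have main (Z : Set S) : ∀ P Q, IsParabolic M P → IsParabolic M Q → P ≤ parabolic M Z →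
      Q ≤ parabolic M Z → IsParabolic M (P ⊓ Q) := by
    induction Z using WellFoundedLT.induction with
    | _ Z ih =>
    intro P Q hP hQ hPZ hQZ
    obtain ⟨u, hu, X, hX, rfl⟩ :=
      hP.exists_of_le (d := 1) hsymm hret (by rwa [conjSub_one])
    obtain ⟨v, hv, Y, hY, rfl⟩ :=
      hQ.exists_of_le (d := 1) hsymm hret (by rwa [conjSub_one])
    rw [one_mul, one_mul, conjSub_inf_conjSub]
    refine IsParabolic.conj u (isParabolic_parabolic_inf_conjSub hsymm hdiag hfree hret hinj ih
      (fun X hX Y hY g hg => parabolic_Cset_eq_or_inf_le hinj (hC Z) hX hY hg) X Y hX hY _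
      (mul_mem (inv_mem hu) hv))
  have htop : parabolic M Set.univ = ⊤ := by
    rw [parabolic, Set.image_univ]
    exact PresentedGroup.closure_range_of _
  exact fun P Q hP hQ => main Set.univ P Q hP hQ (htop ▸ le_top) (htop ▸ le_top)
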